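/- Let β ∈ K with β ∉ {0, −10} be such that the plane sextic C : X⁶ + Y⁶ + Z⁶ + β(X³Y³ + Y³Z³ + X³Z³) = 0 is smooth. Then Aut(C) ⊂ PGL₃(K) equals the subgroup generated by diag(1, ζ₃, 1), diag(1, 1, ζ₃), [X:Z:Y], and [Z:X:Y], and it has order 54 (it is isomorphic to the semidirect product (Z/3Z)² ⋊ Z/6Z). -/

import Mathlib

open MvPolynomial

/-- `GL₃(K)`: the group of invertible `3 × 3` matrices over `K`. -/
abbrev GL3 (K : Type*) [Field K] := (Matrix (Fin 3) (Fin 3) K)ˣ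

/-- `PGL₃(K)`: the quotient of `GL₃(K)` by its center (the scalar matrices). -/
abbrev PGL3 (K : Type*) [Field K] := GL3 K ⧸ Subgroup.center (GL3 K)

variable {K : Type*} [Field K]

/-- The substitution `F(X,Y,Z) ↦ F(A·(X,Y,Z)ᵗ)` for a `3 × 3` matrix `A`. -/
noncomputable def matAct (A : Matrix (Fin 3) (Fin 3) K) (F : MvPolynomial (Fin 3) K) :
    MvPolynomial (Fin 3) K :=
  aeval (fun i => ∑ j, C (A i j) * X j) F

lemma matAct_one (F : MvPolynomial (Fin 3) K) : matAct 1 F = F := by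
  unfold matAct
  have h : (fun i => ∑ j, C ((1 : Matrix (Fin 3) (Fin 3) K) i j) * X j)
      = (X : Fin 3 → MvPolynomial (Fin 3) K) := by
    funext i
    rw [Finset.sum_eq_single i]
    · simp
    · intro b _ hb
      simp [Matrix.one_apply, Ne.symm hb]
    · simp
  rw [h, aeval_X_left_apply]

lemma matAct_matAct (A B : Matrix (Fin 3) (Fin 3) K) (F : MvPolynomial (Fin 3) K) :
    matAct B (matAct A F) = matAct (A * B) F := by
  unfold matAct
  rw [← AlgHom.comp_apply, comp_aeval]
  have h : (fun i => (aeval fun i => ∑ j, C (B i j) * X j) (∑ j, C (A i j) * X j))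
      = fun i => ∑ j : Fin 3, C ((A * B) i j) * (X j : MvPolynomial (Fin 3) K) := by
    funext i
    simp only [map_sum, map_mul, aeval_C, aeval_X, algebraMap_eq, Finset.mul_sum]
    rw [Finset.sum_comm]
    refine Finset.sum_congr rfl fun k _ => ?_
    rw [Matrix.mul_apply, map_sum, Finset.sum_mul]
    refine Finset.sum_congr rfl fun j _ => ?_
    rw [map_mul, mul_assoc]
  rw [h]

lemma matAct_smul (A : Matrix (Fin 3) (Fin 3) K) (c : K) (F : MvPolynomial (Fin 3) K) :
    matAct A (c • F) = c • matAct A F :=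
  map_smul (aeval fun i => ∑ j, C (A i j) * X j) c F

/-- The class of a matrix `A` in `PGL₃(K)` (junk value `1` if `A` is not invertible). -/
noncomputable def pgl (A : Matrix (Fin 3) (Fin 3) K) : PGL3 K := by
  classical
  exact if h : IsUnit A then (QuotientGroup.mk h.unit : PGL3 K) else 1

/-- `F` defines a smooth plane sextic: `F` is homogeneous of degree `6`, and `F` together with
its partial derivatives have no common zero besides the origin. -/
def IsSmoothSextic (F : MvPolynomial (Fin 3) K) : Prop :=
  F.IsHomogeneous 6 ∧
    ∀ p : Fin 3 → K, eval p F = 0 → (∀ i, eval p (pderiv i F) = 0) → p = 0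

/-- The automorphism group of the plane curve `F = 0`: the subgroup of `PGL₃(K)` consisting of
the classes of matrices `A ∈ GL₃(K)` with `F(A·(X,Y,Z)ᵗ) = λ·F(X,Y,Z)` for some `λ ∈ K×`. -/
noncomputable def planeAut (F : MvPolynomial (Fin 3) K) : Subgroup (PGL3 K) where
  carrier := {g | ∃ A : GL3 K, (QuotientGroup.mk A : PGL3 K) = g ∧
    ∃ c : K, c ≠ 0 ∧ matAct (A : Matrix (Fin 3) (Fin 3) K) F = c • F}
  one_mem' := ⟨1, rfl, 1, one_ne_zero, by rw [Units.val_one, matAct_one, one_smul]⟩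
  mul_mem' := by
    rintro g h ⟨A, rfl, c, hc, hA⟩ ⟨B, rfl, d, hd, hB⟩
    exact ⟨A * B, rfl, c * d, mul_ne_zero hc hd, by
      rw [Units.val_mul, ← matAct_matAct, hA, matAct_smul, hB, smul_smul]⟩
  inv_mem' := by
    rintro g ⟨A, rfl, c, hc, hA⟩
    refine ⟨A⁻¹, rfl, c⁻¹, inv_ne_zero hc, ?_⟩
    rw [eq_inv_smul_iff₀ hc, ← matAct_smul, ← hA, matAct_matAct, ← Units.val_mul,
      mul_inv_cancel, Units.val_one, matAct_one]

/-- The symmetric sextic `X⁶ + Y⁶ + Z⁶ + β(X³Y³ + Y³Z³ + X³Z³)`. -/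
noncomputable def symSextic (β : K) : MvPolynomial (Fin 3) K :=
  X 0 ^ 6 + X 1 ^ 6 + X 2 ^ 6
    + C β * (X 0 ^ 3 * X 1 ^ 3 + X 1 ^ 3 * X 2 ^ 3 + X 0 ^ 3 * X 2 ^ 3)

/-! ### The chain rule for linear substitutions -/

lemma matAct_C (A : Matrix (Fin 3) (Fin 3) K) (a : K) : matAct A (C a) = C a :=
  aeval_C _ a

lemma matAct_zero (A : Matrix (Fin 3) (Fin 3) K) : matAct A 0 = 0 :=
  map_zero (aeval fun i => ∑ j, C (A i j) * X j)

lemma matAct_add (A : Matrix (Fin 3) (Fin 3) K) (F G : MvPolynomial (Fin 3) K) :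
    matAct A (F + G) = matAct A F + matAct A G :=
  map_add (aeval fun i => ∑ j, C (A i j) * X j) F G

lemma matAct_mul (A : Matrix (Fin 3) (Fin 3) K) (F G : MvPolynomial (Fin 3) K) :
    matAct A (F * G) = matAct A F * matAct A G :=
  map_mul (aeval fun i => ∑ j, C (A i j) * X j) F G

lemma matAct_X (A : Matrix (Fin 3) (Fin 3) K) (i : Fin 3) :
    matAct A (X i) = ∑ j, C (A i j) * X j :=
  aeval_X _ i

lemma matAct_pow (A : Matrix (Fin 3) (Fin 3) K) (F : MvPolynomial (Fin 3) K) (n : ℕ) :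
    matAct A (F ^ n) = matAct A F ^ n :=
  map_pow (aeval fun i => ∑ j, C (A i j) * X j) F n

lemma eval_matAct (A : Matrix (Fin 3) (Fin 3) K) (F : MvPolynomial (Fin 3) K)
    (x : Fin 3 → K) : eval x (matAct A F) = eval (A.mulVec x) F := by
  induction F using MvPolynomial.induction_on with
  | C a => simp [matAct_C]
  | add p q hp hq => simp [matAct_add, hp, hq]
  | mul_X p i hp => simp [matAct_mul, matAct_X, hp, Matrix.mulVec, dotProduct]

lemma pderiv_matAct (A : Matrix (Fin 3) (Fin 3) K) (F : MvPolynomial (Fin 3) K) (i : Fin 3) :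
    pderiv i (matAct A F) = ∑ j, C (A j i) * matAct A (pderiv j F) := by
  induction F using MvPolynomial.induction_on with
  | C a => simp [matAct_C, matAct_zero]
  | add p q hp hq => simp [matAct_add, hp, hq, mul_add, Finset.sum_add_distrib]
  | mul_X p k hp =>
    have hX : pderiv i (matAct A (X k)) = C (A k i) := by
      rw [matAct_X]
      simp [pderiv_X, Pi.single_apply]
    have h1 (j : Fin 3) : matAct A (pderiv j (X k : MvPolynomial (Fin 3) K))
        = if j = k then 1 else 0 := by
      rw [pderiv_X]
      by_cases h : j = k
      · subst h
        simpa using matAct_C A 1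
      · simpa [h, Pi.single_apply, Ne.symm h] using matAct_C A 0
    simp only [matAct_mul, pderiv_mul, hp, hX, matAct_add, h1, mul_add,
      Finset.sum_add_distrib, Finset.sum_mul]
    simp [mul_comm, mul_left_comm]

/-- If `F ∘ A = c F`, the Hessian form of `F` transforms accordingly. -/
lemma hessian_of_matAct_eq_smul {A : Matrix (Fin 3) (Fin 3) K} {F : MvPolynomial (Fin 3) K}
    {c : K} (h : matAct A F = c • F) (x : Fin 3 → K) (i l : Fin 3) :
    ∑ j, A j i * ∑ k, A k l * eval (A.mulVec x) (pderiv k (pderiv j F))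
      = c * eval x (pderiv l (pderiv i F)) := by
  have h2 := congrArg (fun G => eval x (pderiv l (pderiv i G))) h
  simpa [pderiv_matAct, eval_matAct] using h2

/-! ### The Hessian matrix of the symmetric sextic -/

lemma pderiv_ofNat (i : Fin 3) (n : ℕ) [n.AtLeastTwo] :
    pderiv i (ofNat(n) : MvPolynomial (Fin 3) K) = 0 :=
  Derivation.map_natCast _ n

lemma Fin.exists_ne_ne_three (i : Fin 3) : ∃ j k : Fin 3, i ≠ j ∧ i ≠ k ∧ j ≠ k := by
  decide +revert

lemma Fin.eq_or_eq_or_eq_of_ne {i j k : Fin 3} (hij : i ≠ j) (hik : i ≠ k) (hjk : j ≠ k)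
    (l : Fin 3) : l = i ∨ l = j ∨ l = k := by
  decide +revert

lemma Fin.sum_three_of_ne {M : Type*} [AddCommMonoid M] {i j k : Fin 3} (hij : i ≠ j)
    (hik : i ≠ k) (hjk : j ≠ k) (f : Fin 3 → M) : ∑ l, f l = f i + f j + f k := by
  have h : (Finset.univ : Finset (Fin 3)) = {i, j, k} := by
    decide +revert
  rw [h, Finset.sum_insert (by simp [hij, hik]), Finset.sum_insert (by simp [hjk]),
    Finset.sum_singleton, add_assoc]

lemma eval_hessian_symSextic_self (β : K) (x : Fin 3 → K) {i j k : Fin 3}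
    (hij : i ≠ j) (hik : i ≠ k) (hjk : j ≠ k) :
    eval x (pderiv i (pderiv i (symSextic β)))
      = 30 * x i ^ 4 + 6 * β * x i * (x j ^ 3 + x k ^ 3) := by
  fin_cases i <;> fin_cases j <;> fin_cases k <;> simp_all [symSextic, pderiv_X, pderiv_ofNat] <;>
    ring

lemma eval_hessian_symSextic_of_ne (β : K) (x : Fin 3 → K) {i j : Fin 3} (hij : i ≠ j) :
    eval x (pderiv i (pderiv j (symSextic β))) = 9 * β * x i ^ 2 * x j ^ 2 := by
  fin_cases i <;> fin_cases j <;> simp_all [symSextic, pderiv_X, pderiv_ofNat] <;> ring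

/-- The `i`-th column of the Hessian matrix vanishes on the line `x i = 0`. -/
lemma eval_hessian_symSextic_eq_zero (β : K) (x : Fin 3 → K) {i : Fin 3} (hx : x i = 0)
    (l : Fin 3) : eval x (pderiv l (pderiv i (symSextic β))) = 0 := by
  by_cases h : l = i
  · subst h
    obtain ⟨j, k, hij, hik, hjk⟩ := Fin.exists_ne_ne_three l
    rw [eval_hessian_symSextic_self β x hij hik hjk, hx]
    ring
  · rw [eval_hessian_symSextic_of_ne β x h, hx]
    ring

lemma coeffs_eq_zero_of_quartic [CharZero K] {a b c d e : K}
    (h : ∀ t : K, a + b * t + c * t ^ 2 + d * t ^ 3 + e * t ^ 4 = 0) :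
    a = 0 ∧ b = 0 ∧ c = 0 ∧ d = 0 ∧ e = 0 := by
  have h0 := h 0
  have h1 := h 1
  have h2 := h (-1)
  have h3 := h 2
  have h4 := h (-2)
  have ha : a = 0 := by linear_combination h0
  have e1 : 24 * e = 0 := by linear_combination h3 + h4 - 4 * h1 - 4 * h2 + 6 * ha
  have d1 : 12 * d = 0 := by linear_combination h3 - h4 - 2 * h1 + 2 * h2
  have he : e = 0 := by simpa using e1
  have hd : d = 0 := by simpa using d1
  have c1 : 2 * c = 0 := by linear_combination h1 + h2 - 2 * ha - 2 * he
  have b1 : 2 * b = 0 := by linear_combination h1 - h2 - 2 * hd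
  exact ⟨ha, by simpa using b1, by simpa using c1, hd, he⟩

lemma cubic_eq_zero_of_linear_mul_eq_zero [CharZero K] {u v a b c d : K} (huv : u ≠ 0 ∨ v ≠ 0)
    (h : ∀ t : K, (u + v * t) * (a + b * t + c * t ^ 2 + d * t ^ 3) = 0) :
    a = 0 ∧ b = 0 ∧ c = 0 ∧ d = 0 := by
  obtain ⟨h0, h1, h2, h3, h4⟩ := coeffs_eq_zero_of_quartic (a := u * a) (b := u * b + v * a)
    (c := u * c + v * b) (d := u * d + v * c) (e := v * d) fun t => by linear_combination h t
  by_cases hu : u = 0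
  · subst hu
    have hv : v ≠ 0 := by simpa using huv
    simp_all
  · simp_all

/-- If the row of the Hessian form belonging to the coordinate `Z` kills the vector
`(p, q, r)` along the line `Z = u X + v Y`, the line being different from `Z = 0`, then its
coefficients are severely restricted. -/
lemma line_condition [CharZero K] {β p q r u v : K} (hβ : β ≠ 0) (huv : u ≠ 0 ∨ v ≠ 0)
    (h : ∀ x y z : K, z = u * x + v * y →
      r * (30 * z ^ 4 + 6 * β * z * (x ^ 3 + y ^ 3)) + p * (9 * β * x ^ 2 * z ^ 2)
        + q * (9 * β * y ^ 2 * z ^ 2) = 0) :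
    (p = 0 ∧ q = 0 ∧ r = 0) ∨ (u ≠ 0 ∧ v ≠ 0 ∧ β = 10 * u ^ 3 ∧ β = 10 * v ^ 3) := by
  obtain ⟨h0, h1, h2, h3⟩ := cubic_eq_zero_of_linear_mul_eq_zero huv
    (a := r * (10 * u ^ 3 + 2 * β) + 3 * β * u * p) (b := 3 * v * (10 * r * u ^ 2 + β * p))
    (c := 3 * u * (10 * r * v ^ 2 + β * q)) (d := r * (10 * v ^ 3 + 2 * β) + 3 * β * v * q)
    fun t => by
      have h3 : (3 : K) ≠ 0 := by norm_num
      refine mul_left_cancel₀ h3 ?_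
      linear_combination h 1 t _ rfl
  by_cases hu : u = 0
  · subst hu
    have hv : v ≠ 0 := by simpa using huv
    have hr : r = 0 := by simpa [hβ] using h0
    subst hr
    simp_all
  by_cases hv : v = 0
  · subst hv
    have hr : r = 0 := by simpa [hβ] using h3
    subst hr
    simp_all
  have e1 : 10 * r * u ^ 2 + β * p = 0 := by simpa [hv] using h1
  have e2 : 10 * r * v ^ 2 + β * q = 0 := by simpa [hu] using h2
  by_cases hr : r = 0
  · subst hr
    simp_all
  have f1 : 2 * r * (β - 10 * u ^ 3) = 0 := by linear_combination h0 - 3 * u * e1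
  have f2 : 2 * r * (β - 10 * v ^ 3) = 0 := by linear_combination h3 - 3 * v * e2
  right
  simp only [mul_eq_zero, OfNat.ofNat_ne_zero, hr, false_or, sub_eq_zero] at f1 f2
  exact ⟨hu, hv, f1, f2⟩

/-- A vector in the kernel of the Hessian form along a whole line is a multiple of a
coordinate vector, unless `β = -10`. -/
lemma eq_single_of_hessian_eq_zero [CharZero K] {β : K} (hβ0 : β ≠ 0) (hβ10 : β ≠ -10)
    {p L : Fin 3 → K} (hLp : ∑ j, L j * p j = 1)
    (h : ∀ y : Fin 3 → K, ∑ j, L j * y j = 0 →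
      ∀ k, ∑ j, p j * eval y (pderiv k (pderiv j (symSextic β))) = 0) :
    ∃ k, p k ≠ 0 ∧ ∀ j, j ≠ k → p j = 0 := by
  have hp : ¬ ∀ j, p j = 0 := fun h0 => by simp [h0] at hLp
  have hline : ∀ i j k : Fin 3, i ≠ j → i ≠ k → j ≠ k → L k ≠ 0 → L i ≠ 0 ∨ L j ≠ 0 →
      L i ≠ 0 ∧ L j ≠ 0 ∧ β * L k ^ 3 = -10 * L i ^ 3 ∧ β * L k ^ 3 = -10 * L j ^ 3 := by
    intro i j k hij hik hjk hk hL
    have hsum := Fin.sum_three_of_ne (M := K) hij hik hjk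
    rcases line_condition (p := p i) (q := p j) (r := p k) (u := - L i / L k) (v := - L j / L k)
      hβ0 (by simpa [hk] using hL) (fun x y z hz => by
        let w : Fin 3 → K := fun l => if l = i then x else if l = j then y else z
        have hwi : w i = x := by simp [w]
        have hwj : w j = y := by simp [w, hij.symm]
        have hwk : w k = z := by simp [w, hik.symm, hjk.symm]
        have := h w (by rw [hsum, hwi, hwj, hwk, hz]; field_simp; ring) k
        rw [hsum, eval_hessian_symSextic_of_ne _ _ hik.symm,
          eval_hessian_symSextic_of_ne _ _ hjk.symm,
          eval_hessian_symSextic_self _ _ hik.symm hjk.symm hij, hwi, hwj, hwk] at this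
        linear_combination this) with h0 | ⟨hu, hv, h1, h2⟩
    · refine absurd (fun l => ?_) hp
      rcases Fin.eq_or_eq_or_eq_of_ne hij hik hjk l with rfl | rfl | rfl
      exacts [h0.1, h0.2.1, h0.2.2]
    · refine ⟨by simpa [hk] using hu, by simpa [hk] using hv, ?_, ?_⟩
      · rw [h1]; field_simp
      · rw [h2]; field_simp
  have hfull : ∀ i j k : Fin 3, i ≠ j → i ≠ k → j ≠ k → L k ≠ 0 → L i = 0 ∧ L j = 0 := by
    intro i j k hij hik hjk hk
    by_contra hne
    obtain ⟨hi, hj, h1, h2⟩ := hline i j k hij hik hjk hk (by tauto)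
    obtain ⟨-, -, h3, -⟩ := hline j k i hjk hij.symm hik.symm hi (Or.inl hj)
    have h4 : (10 : K) * (L i ^ 3 - L j ^ 3) = 0 := by linear_combination h1 - h2
    have h5 : L i ^ 3 = L j ^ 3 := by simpa [sub_eq_zero] using h4
    refine hβ10 (mul_right_cancel₀ (pow_ne_zero 3 hi) ?_)
    rw [h3, h5]
  obtain ⟨k, hk⟩ : ∃ k, L k ≠ 0 := by
    by_contra! h0
    simp [h0] at hLp
  obtain ⟨i, j, hki, hkj, hij⟩ := Fin.exists_ne_ne_three k
  obtain ⟨hi, hj⟩ := hfull i j k hij hki.symm hkj.symm hk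
  have hcoord : ∀ l, l ≠ k → p l = 0 := by
    intro l hlk
    have hLl : L l = 0 := by
      rcases Fin.eq_or_eq_or_eq_of_ne hki hkj hij l with rfl | rfl | rfl
      exacts [absurd rfl hlk, hi, hj]
    obtain ⟨m, hml, hmk⟩ := (by decide : ∀ l k : Fin 3, ∃ m, m ≠ l ∧ m ≠ k) l k
    have := h (Pi.single l 1) (by simp [Pi.single_apply, hLl]) l
    rw [Finset.sum_eq_single l (fun b _ hb => by
      rw [eval_hessian_symSextic_of_ne _ _ hb.symm]; simp [hb]) (by simp),
      eval_hessian_symSextic_self _ _ hml.symm hlk hmk] at this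
    simpa [hml, hlk.symm] using this
  refine ⟨k, fun h0 => hp fun l => ?_, hcoord⟩
  by_cases hl : l = k
  · rw [hl, h0]
  · exact hcoord l hl

/-- Each column of a matrix preserving the symmetric sextic has exactly one nonzero entry. -/
lemma column_of_matAct_symSextic [CharZero K] {β c : K} (hβ0 : β ≠ 0) (hβ10 : β ≠ -10)
    (A : GL3 K) (h : matAct (A : Matrix (Fin 3) (Fin 3) K) (symSextic β) = c • symSextic β)
    (i : Fin 3) : ∃ k, A.val k i ≠ 0 ∧ ∀ j, j ≠ k → A.val j i = 0 := by
  refine eq_single_of_hessian_eq_zero hβ0 hβ10 (p := fun j => A.val j i)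
    (L := fun j => A⁻¹.val i j) ?_ ?_
  · have := congrFun (congrFun A.inv_mul i) i
    simpa [Matrix.mul_apply] using this
  · intro y hy k
    have hA : A.val.mulVec (A⁻¹.val.mulVec y) = y := by
      rw [Matrix.mulVec_mulVec, A.mul_inv, Matrix.one_mulVec]
    have hx : A⁻¹.val.mulVec y i = 0 := hy
    have hH : Matrix.vecMul (fun k => ∑ j, A.val j i *
        eval y (pderiv k (pderiv j (symSextic β)))) A.val = 0 := by
      funext l
      have := hessian_of_matAct_eq_smul h (A⁻¹.val.mulVec y) i l
      rw [eval_hessian_symSextic_eq_zero β _ hx, hA, mul_zero] at this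
      rw [Pi.zero_apply, ← this]
      simp only [Matrix.vecMul, dotProduct, Finset.sum_mul, Finset.mul_sum]
      rw [Finset.sum_comm]
      exact Finset.sum_congr rfl fun _ _ => Finset.sum_congr rfl fun _ _ => by ring
    have := congrArg (fun w => Matrix.vecMul w A⁻¹.val) hH
    simp only [Matrix.vecMul_vecMul, A.mul_inv, Matrix.vecMul_one, Matrix.zero_vecMul] at this
    exact congrFun this k

/-! ### Classes of matrices in `PGL₃` -/

lemma pgl_val (A : GL3 K) : pgl A.val = (QuotientGroup.mk A : PGL3 K) := by
  unfold pgl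
  rw [dif_pos A.isUnit]
  congr 1
  exact Units.ext A.isUnit.unit_spec

lemma pgl_mul {A B : Matrix (Fin 3) (Fin 3) K} (hA : IsUnit A) (hB : IsUnit B) :
    pgl (A * B) = pgl A * pgl B := by
  lift A to GL3 K using hA
  lift B to GL3 K using hB
  rw [← Units.val_mul, pgl_val, pgl_val, pgl_val, QuotientGroup.mk_mul]

lemma pgl_one : pgl (1 : Matrix (Fin 3) (Fin 3) K) = 1 :=
  pgl_val 1

lemma pgl_pow {A : Matrix (Fin 3) (Fin 3) K} (hA : IsUnit A) (n : ℕ) :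
    pgl (A ^ n) = pgl A ^ n := by
  lift A to GL3 K using hA
  rw [← Units.val_pow_eq_pow_val, pgl_val, pgl_val, QuotientGroup.mk_pow]

lemma pgl_eq_one_iff {A : Matrix (Fin 3) (Fin 3) K} (hA : IsUnit A) :
    pgl A = 1 ↔ ∃ c, A = Matrix.scalar (Fin 3) c := by
  lift A to GL3 K using hA
  rw [pgl_val, QuotientGroup.eq_one_iff,
    Matrix.GeneralLinearGroup.mem_center_iff_val_mem_range_scalar]
  simp only [Set.mem_range, eq_comm]

lemma pgl_smul {A : Matrix (Fin 3) (Fin 3) K} (hA : IsUnit A) {c : K} (hc : c ≠ 0) :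
    pgl (c • A) = pgl A := by
  have hs : IsUnit (Matrix.scalar (Fin 3) c) := (isUnit_iff_ne_zero.2 hc).map _
  have h : c • A = Matrix.scalar (Fin 3) c * A := by
    rw [Matrix.scalar_apply, ← Matrix.smul_eq_diagonal_mul]
  rw [h, pgl_mul hs hA, (pgl_eq_one_iff hs).2 ⟨c, rfl⟩, one_mul]

lemma pgl_mem_planeAut {F : MvPolynomial (Fin 3) K} {A : Matrix (Fin 3) (Fin 3) K}
    (hA : IsUnit A) (h : matAct A F = F) : pgl A ∈ planeAut F := by
  lift A to GL3 K using hA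
  exact ⟨A, (pgl_val A).symm, 1, one_ne_zero, by rw [h, one_smul]⟩

/-! ### Semidirect products of cyclic groups by generators and relations -/

section SemidirectProduct

variable {P : Type*} [Group P]

/-- The homomorphism from a cyclic group of order `n` determined by an element `x` with
`x ^ n = 1`. -/
def zmodPowHom (n : ℕ) (x : P) (hx : x ^ n = 1) : Multiplicative (ZMod n) →* P :=
  AddMonoidHom.toMultiplicativeLeft
    (ZMod.lift n ⟨zmultiplesHom (Additive P) (Additive.ofMul x), by
      simpa [← ofMul_pow] using hx⟩)

lemma zmodPowHom_apply (n : ℕ) (x : P) (hx : x ^ n = 1) (k : ℕ) :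
    zmodPowHom n x hx (Multiplicative.ofAdd 1 ^ k) = x ^ k := by
  have h : zmodPowHom n x hx (Multiplicative.ofAdd 1) = x := by
    have := ZMod.lift_coe n ⟨zmultiplesHom (Additive P) (Additive.ofMul x), by
      simpa [← ofMul_pow] using hx⟩ 1
    simp only [Int.cast_one] at this
    change Additive.toMul _ = x
    simp [this]
  rw [map_pow, h]

lemma exists_lt_ofAdd_one_pow (n : ℕ) [NeZero n] (x : Multiplicative (ZMod n)) :
    ∃ k < n, x = Multiplicative.ofAdd 1 ^ k :=
  ⟨ZMod.val x.toAdd, ZMod.val_lt _, by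
    rw [← ofAdd_nsmul, nsmul_one, ZMod.natCast_zmod_val, ofAdd_toAdd]⟩

/-- The elementary abelian group of order `9`. -/
abbrev ThreeThree := Multiplicative (ZMod 3) × Multiplicative (ZMod 3)

/-- The automorphism `(a, b) ↦ (-a - b, -b)` of order `6`. -/
def threeThreeAut : MulAut ThreeThree where
  toFun x := ((x.1 * x.2)⁻¹, x.2⁻¹)
  invFun x := (x.1⁻¹ * x.2, x.2⁻¹)
  left_inv x := by ext <;> simp
  right_inv x := by ext <;> simp
  map_mul' x y := by ext <;> simp <;> abel

lemma threeThreeAut_pow_six : threeThreeAut ^ 6 = 1 := by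
  ext x : 1
  revert x
  decide

/-- The action of a cyclic group of order `6` on the elementary abelian group of order `9`. -/
def threeThreeAction : Multiplicative (ZMod 6) →* MulAut ThreeThree :=
  zmodPowHom 6 threeThreeAut threeThreeAut_pow_six

lemma exists_hom_of_relations {d t g : P} (hd : d ^ 3 = 1) (ht : t ^ 3 = 1) (hg : g ^ 6 = 1)
    (hdt : Commute d t) (hgd : g * d = d⁻¹ * g) (hgt : g * t = d⁻¹ * t⁻¹ * g) :
    ∃ f : ThreeThree ⋊[threeThreeAction] Multiplicative (ZMod 6) →* P, ∀ a b k : ℕ,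
      f ⟨(Multiplicative.ofAdd 1 ^ a, Multiplicative.ofAdd 1 ^ b), Multiplicative.ofAdd 1 ^ k⟩
        = d ^ a * t ^ b * g ^ k := by
  let fd := zmodPowHom 3 d hd
  let ft := zmodPowHom 3 t ht
  let fg := zmodPowHom 6 g hg
  have hcomm : ∀ x y, Commute (fd x) (ft y) := by
    intro x y
    obtain ⟨a, -, rfl⟩ := exists_lt_ofAdd_one_pow 3 x
    obtain ⟨b, -, rfl⟩ := exists_lt_ofAdd_one_pow 3 y
    simp only [fd, ft, zmodPowHom_apply]
    exact hdt.pow_pow a b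
  let fn := fd.noncommCoprod ft hcomm
  have hfn : ∀ x y, fn (x, y) = fd x * ft y := fun x y => rfl
  have hbase : ∀ x : ThreeThree, fn (threeThreeAut x) = g * fn x * g⁻¹ := by
    rintro ⟨x, y⟩
    change fn ((x * y)⁻¹, y⁻¹) = _
    rw [hfn, hfn, map_inv, map_inv, map_mul]
    obtain ⟨a, -, rfl⟩ := exists_lt_ofAdd_one_pow 3 x
    obtain ⟨b, -, rfl⟩ := exists_lt_ofAdd_one_pow 3 y
    simp only [fd, ft, zmodPowHom_apply]
    have h1 : g * d * g⁻¹ = d⁻¹ := by rw [hgd, mul_inv_cancel_right]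
    have h2 : g * t * g⁻¹ = d⁻¹ * t⁻¹ := by rw [hgt, mul_inv_cancel_right]
    have h3 : g * (d ^ a * t ^ b) * g⁻¹ = (g * d * g⁻¹) ^ a * (g * t * g⁻¹) ^ b := by
      rw [conj_pow, conj_pow]; group
    rw [h3, h1, h2, hdt.inv_inv.mul_pow, ← mul_assoc, inv_pow, inv_pow, inv_pow, mul_inv_rev,
      ← inv_pow, ← inv_pow, ← inv_pow, ((Commute.refl d⁻¹).pow_pow b a).eq]
  have hpow : ∀ (k : ℕ) (x : ThreeThree),
      fn ((threeThreeAut ^ k) x) = g ^ k * fn x * (g ^ k)⁻¹ := by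
    intro k
    induction k with
    | zero => intro x; simp
    | succ k ih =>
      intro x
      rw [pow_succ', MulAut.mul_apply, hbase, ih, pow_succ']
      group
  refine ⟨SemidirectProduct.lift fn fg ?_, fun a b k => ?_⟩
  · intro z
    obtain ⟨k, -, rfl⟩ := exists_lt_ofAdd_one_pow 6 z
    ext x : 1
    simp only [MonoidHom.comp_apply, MulEquiv.coe_toMonoidHom, threeThreeAction, fg,
      zmodPowHom_apply, MulAut.conj_apply]
    exact hpow k x
  · change fn _ * fg _ = _
    rw [hfn]
    simp only [fd, ft, fg, zmodPowHom_apply]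

end SemidirectProduct

/-! ### The group of order `54` -/

section Matrices

variable (ζ : K)

/-- The diagonal matrix `diag(1, ζ, ζ²)`. -/
def matD : Matrix (Fin 3) (Fin 3) K := !![1, 0, 0; 0, ζ, 0; 0, 0, ζ ^ 2]

/-- The diagonal matrix `diag(1, ζ, 1)`. -/
def matE₁ : Matrix (Fin 3) (Fin 3) K := !![1, 0, 0; 0, ζ, 0; 0, 0, 1]

/-- The diagonal matrix `diag(1, 1, ζ)`. -/
def matE₂ : Matrix (Fin 3) (Fin 3) K := !![1, 0, 0; 0, 1, 0; 0, 0, ζ]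

/-- The transposition `[X:Z:Y]`. -/
def matS : Matrix (Fin 3) (Fin 3) K := !![1, 0, 0; 0, 0, 1; 0, 1, 0]

/-- The cyclic permutation `[Z:X:Y]`. -/
def matT : Matrix (Fin 3) (Fin 3) K := !![0, 0, 1; 1, 0, 0; 0, 1, 0]

/-- The monomial matrix `[Y:X:ζZ]`, whose class has order `6`. -/
def matG : Matrix (Fin 3) (Fin 3) K := !![0, 1, 0; 1, 0, 0; 0, 0, ζ]

variable {ζ}

lemma isUnit_matD (hζ : ζ ≠ 0) : IsUnit (matD ζ) := by
  simp [Matrix.isUnit_iff_isUnit_det, matD, Matrix.det_fin_three, hζ]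

lemma isUnit_matE₁ (hζ : ζ ≠ 0) : IsUnit (matE₁ ζ) := by
  simp [Matrix.isUnit_iff_isUnit_det, matE₁, Matrix.det_fin_three, hζ]

lemma isUnit_matE₂ (hζ : ζ ≠ 0) : IsUnit (matE₂ ζ) := by
  simp [Matrix.isUnit_iff_isUnit_det, matE₂, Matrix.det_fin_three, hζ]

lemma isUnit_matG (hζ : ζ ≠ 0) : IsUnit (matG ζ) := by
  simp [Matrix.isUnit_iff_isUnit_det, matG, Matrix.det_fin_three, hζ]

lemma isUnit_matS : IsUnit (matS : Matrix (Fin 3) (Fin 3) K) := by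
  simp [Matrix.isUnit_iff_isUnit_det, matS, Matrix.det_fin_three]

lemma isUnit_matT : IsUnit (matT : Matrix (Fin 3) (Fin 3) K) := by
  simp [Matrix.isUnit_iff_isUnit_det, matT, Matrix.det_fin_three]

lemma matD_pow (n : ℕ) : matD ζ ^ n = !![1, 0, 0; 0, ζ ^ n, 0; 0, 0, ζ ^ (2 * n)] := by
  induction n with
  | zero => simp [Matrix.one_fin_three]
  | succ n ih => rw [pow_succ, ih]; simp [matD, pow_succ, mul_add, mul_assoc]

lemma matE₁_pow (n : ℕ) : matE₁ ζ ^ n = !![1, 0, 0; 0, ζ ^ n, 0; 0, 0, 1] := by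
  induction n with
  | zero => simp [Matrix.one_fin_three]
  | succ n ih => rw [pow_succ, ih]; simp [matE₁, pow_succ]

lemma matE₂_pow (n : ℕ) : matE₂ ζ ^ n = !![1, 0, 0; 0, 1, 0; 0, 0, ζ ^ n] := by
  induction n with
  | zero => simp [Matrix.one_fin_three]
  | succ n ih => rw [pow_succ, ih]; simp [matE₂, pow_succ]

lemma matG_sq : matG ζ ^ 2 = !![1, 0, 0; 0, 1, 0; 0, 0, ζ ^ 2] := by
  simp [matG, pow_succ]

lemma matG_pow_two_mul (n : ℕ) :
    matG ζ ^ (2 * n) = !![1, 0, 0; 0, 1, 0; 0, 0, ζ ^ (2 * n)] := by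
  rw [pow_mul, matG_sq, pow_mul]
  exact matE₂_pow n

lemma matT_sq : (matT : Matrix (Fin 3) (Fin 3) K) ^ 2 = !![0, 1, 0; 0, 0, 1; 1, 0, 0] := by
  simp [matT, pow_succ]

lemma pgl_matD_pow_three (h0 : ζ ≠ 0) (h3 : ζ ^ 3 = 1) : pgl (matD ζ) ^ 3 = 1 := by
  rw [← pgl_pow (isUnit_matD h0), matD_pow, pow_mul', h3, one_pow, ← Matrix.one_fin_three,
    pgl_one]

lemma pgl_matT_pow_three : pgl (matT : Matrix (Fin 3) (Fin 3) K) ^ 3 = 1 := by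
  rw [← pgl_pow isUnit_matT, pow_succ, matT_sq]
  simp [matT, ← Matrix.one_fin_three, pgl_one]

lemma pgl_matG_pow_six (h0 : ζ ≠ 0) (h3 : ζ ^ 3 = 1) : pgl (matG ζ) ^ 6 = 1 := by
  rw [← pgl_pow (isUnit_matG h0), matG_pow_two_mul 3, pow_mul', h3, one_pow,
    ← Matrix.one_fin_three, pgl_one]

lemma commute_pgl_matD_matT (h0 : ζ ≠ 0) (h3 : ζ ^ 3 = 1) :
    Commute (pgl (matD ζ)) (pgl matT) := by
  have h : matD ζ * matT = ζ • (matT * matD ζ) := by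
    ext i j
    fin_cases i <;> fin_cases j <;> simp [matD, matT] <;>
      first | linear_combination -h3 | ring
  rw [Commute, SemiconjBy, ← pgl_mul (isUnit_matD h0) isUnit_matT, h,
    pgl_smul (isUnit_matT.mul (isUnit_matD h0)) h0, pgl_mul isUnit_matT (isUnit_matD h0)]

lemma pgl_matG_mul_matD (h0 : ζ ≠ 0) (h3 : ζ ^ 3 = 1) :
    pgl (matG ζ) * pgl (matD ζ) = (pgl (matD ζ))⁻¹ * pgl (matG ζ) := by
  have h : matD ζ * (matG ζ * matD ζ) = ζ • matG ζ := by
    ext i j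
    fin_cases i <;> fin_cases j <;> simp [matD, matG]; linear_combination ζ ^ 2 * h3
  have hD := isUnit_matD h0
  have hG := isUnit_matG h0
  rw [eq_inv_mul_iff_mul_eq, ← pgl_mul hG hD, ← pgl_mul hD (hG.mul hD), h, pgl_smul hG h0]

lemma pgl_matG_mul_matT (h0 : ζ ≠ 0) (h3 : ζ ^ 3 = 1) :
    pgl (matG ζ) * pgl matT = (pgl (matD ζ))⁻¹ * (pgl matT)⁻¹ * pgl (matG ζ) := by
  have h : matT * matD ζ * (matG ζ * matT) = matG ζ := by
    ext i j
    fin_cases i <;> fin_cases j <;> simp [matD, matG, matT]; linear_combination h3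
  have hD := isUnit_matD h0
  have hG := isUnit_matG h0
  have hT := isUnit_matT (K := K)
  rw [← mul_inv_rev, eq_inv_mul_iff_mul_eq, ← pgl_mul hG hT, ← pgl_mul hT hD,
    ← pgl_mul (hT.mul hD) (hG.mul hT), h]

lemma eq_zero_of_pgl_eq_one (hζ : IsPrimitiveRoot ζ 3) {a b k : ℕ} (ha : a < 3) (hb : b < 3)
    (hk : k < 6) (h : pgl (matD ζ) ^ a * pgl matT ^ b * pgl (matG ζ) ^ k = 1) :
    a = 0 ∧ b = 0 ∧ k = 0 := by
  have h0 : ζ ≠ 0 := hζ.ne_zero (by norm_num)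
  have hD := (isUnit_matD h0).pow a
  have hG := (isUnit_matG h0).pow k
  have hT := (isUnit_matT (K := K)).pow b
  rw [← pgl_pow (isUnit_matD h0), ← pgl_pow (isUnit_matG h0), ← pgl_pow isUnit_matT,
    ← pgl_mul hD hT, ← pgl_mul (hD.mul hT) hG, pgl_eq_one_iff ((hD.mul hT).mul hG)] at h
  obtain ⟨c, hc⟩ := h
  have hentry : ∀ i j, (matD ζ ^ a * matT ^ b * matG ζ ^ k : Matrix (Fin 3) (Fin 3) K) i j
      = if i = j then c else 0 := by
    intro i j
    rw [hc, Matrix.scalar_apply, Matrix.diagonal_apply]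
  obtain ⟨m, hm | hm⟩ := k.even_or_odd'
  · rw [hm, matG_pow_two_mul, matD_pow] at hentry
    have hb0 : b = 0 := by
      by_contra hb0
      have h3 := hentry 0 1
      have h4 := hentry 0 2
      obtain rfl | rfl : b = 1 ∨ b = 2 := by omega
      · simp [matT, h0] at h4
      · rw [matT_sq] at h3
        simp at h3
    subst hb0
    have h1 := hentry 0 0
    have h2 := hentry 1 1
    have h3 := hentry 2 2
    simp at h1 h2 h3
    rw [← h1] at h2 h3
    have ha0 : a = 0 := Nat.eq_zero_of_dvd_of_lt ((hζ.pow_eq_one_iff_dvd a).1 h2) ha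
    subst ha0
    simp only [mul_zero, pow_zero, one_mul] at h3
    have := (hζ.pow_eq_one_iff_dvd _).1 h3
    omega
  · exfalso
    rw [hm, pow_succ, matG_pow_two_mul, matD_pow] at hentry
    obtain rfl | rfl | rfl : b = 0 ∨ b = 1 ∨ b = 2 := by omega
    · simpa [matG] using hentry 0 1
    · simpa [matT, matG, h0] using hentry 0 2
    · rw [matT_sq] at hentry
      simpa [matG, h0] using hentry 1 2

lemma matAct_of_monomial (h3 : ζ ^ 3 = 1) (β : K) {A : Matrix (Fin 3) (Fin 3) K}
    (hA : A = matD ζ ∨ A = matT ∨ A = matG ζ) : matAct A (symSextic β) = symSextic β := by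
  have hC : (C ζ : MvPolynomial (Fin 3) K) ^ 3 = 1 := by rw [← C_pow, h3, C_1]
  have hC6 : (C ζ : MvPolynomial (Fin 3) K) ^ 6 = 1 := by
    rw [show 6 = 3 * 2 from rfl, pow_mul, hC, one_pow]
  have hC12 : (C ζ : MvPolynomial (Fin 3) K) ^ 12 = 1 := by
    rw [show 12 = 3 * 4 from rfl, pow_mul, hC, one_pow]
  rcases hA with rfl | rfl | rfl <;>
    simp only [symSextic, matAct_add, matAct_mul, matAct_pow, matAct_C, matAct_X,
      Fin.sum_univ_three] <;>
    simp [matD, matT, matG, mul_pow, ← pow_mul, hC, hC6, hC12] <;> ring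

lemma exists_hom_pgl (hζ : IsPrimitiveRoot ζ 3) :
    ∃ f : ThreeThree ⋊[threeThreeAction] Multiplicative (ZMod 6) →* PGL3 K,
      Function.Injective f ∧
        f.range = Subgroup.closure {pgl (matD ζ), pgl matT, pgl (matG ζ)} := by
  have h0 : ζ ≠ 0 := hζ.ne_zero (by norm_num)
  have h3 := hζ.pow_eq_one
  obtain ⟨f, hf⟩ := exists_hom_of_relations (pgl_matD_pow_three h0 h3) pgl_matT_pow_three
    (pgl_matG_pow_six h0 h3) (commute_pgl_matD_matT h0 h3) (pgl_matG_mul_matD h0 h3)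
    (pgl_matG_mul_matT h0 h3)
  refine ⟨f, (injective_iff_map_eq_one f).2 ?_, le_antisymm ?_ ?_⟩
  · rintro ⟨⟨x, y⟩, z⟩ hx
    obtain ⟨a, ha, rfl⟩ := exists_lt_ofAdd_one_pow 3 x
    obtain ⟨b, hb, rfl⟩ := exists_lt_ofAdd_one_pow 3 y
    obtain ⟨k, hk, rfl⟩ := exists_lt_ofAdd_one_pow 6 z
    rw [hf] at hx
    obtain ⟨rfl, rfl, rfl⟩ := eq_zero_of_pgl_eq_one hζ ha hb hk hx
    rfl
  · rintro _ ⟨⟨⟨x, y⟩, z⟩, rfl⟩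
    obtain ⟨a, -, rfl⟩ := exists_lt_ofAdd_one_pow 3 x
    obtain ⟨b, -, rfl⟩ := exists_lt_ofAdd_one_pow 3 y
    obtain ⟨k, -, rfl⟩ := exists_lt_ofAdd_one_pow 6 z
    rw [hf]
    exact mul_mem (mul_mem (pow_mem (Subgroup.subset_closure (by simp)) a)
      (pow_mem (Subgroup.subset_closure (by simp)) b))
      (pow_mem (Subgroup.subset_closure (by simp)) k)
  · rw [Subgroup.closure_le]
    rintro _ (rfl | rfl | rfl)
    exacts [⟨_, (hf 1 0 0).trans (by simp)⟩, ⟨_, (hf 0 1 0).trans (by simp)⟩,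
      ⟨_, (hf 0 0 1).trans (by simp)⟩]

/-- The generators `diag(1, ζ, 1)`, `diag(1, 1, ζ)`, `[X:Z:Y]`, `[Z:X:Y]` lie in the subgroup
generated by `diag(1, ζ, ζ²)`, `[Z:X:Y]` and `[Y:X:ζZ]`. -/
lemma closure_le_closure_pgl (h0 : ζ ≠ 0) (h3 : ζ ^ 3 = 1) :
    Subgroup.closure {pgl (matE₁ ζ), pgl (matE₂ ζ), pgl matS, pgl matT}
      ≤ Subgroup.closure {pgl (matD ζ), pgl matT, pgl (matG ζ)} := by
  have hD := isUnit_matD h0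
  have hG := isUnit_matG h0
  have hT := isUnit_matT (K := K)
  have mD : pgl (matD ζ) ∈ Subgroup.closure {pgl (matD ζ), pgl matT, pgl (matG ζ)} :=
    Subgroup.subset_closure (by simp)
  have mT : pgl matT ∈ Subgroup.closure {pgl (matD ζ), pgl matT, pgl (matG ζ)} :=
    Subgroup.subset_closure (by simp)
  have mG : pgl (matG ζ) ∈ Subgroup.closure {pgl (matD ζ), pgl matT, pgl (matG ζ)} :=
    Subgroup.subset_closure (by simp)
  have h4 : ζ ^ 4 = ζ := by rw [pow_succ, h3, one_mul]
  have hE₂ : matE₂ ζ = matG ζ ^ 4 := by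
    rw [matG_pow_two_mul 2, matE₂, h4]
  have hE₁ : matE₁ ζ = matD ζ * matG ζ ^ 4 := by
    rw [← hE₂]
    simp [matD, matE₁, matE₂, ← pow_succ, h3]
  have hS : matS * matT = matT * matG ζ ^ 3 := by
    rw [pow_succ, matG_sq]
    simp [matS, matT, matG, ← pow_succ, h3]
  have hS' : pgl matS = pgl matT * pgl (matG ζ) ^ 3 * (pgl matT)⁻¹ := by
    rw [eq_mul_inv_iff_mul_eq, ← pgl_mul isUnit_matS hT, hS, pgl_mul hT (hG.pow 3), pgl_pow hG]
  rw [Subgroup.closure_le]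
  rintro _ (rfl | rfl | rfl | rfl)
  · rw [hE₁, pgl_mul hD (hG.pow 4), pgl_pow hG]
    exact mul_mem mD (pow_mem mG 4)
  · rw [hE₂, pgl_pow hG]
    exact pow_mem mG 4
  · rw [hS']
    exact mul_mem (mul_mem mT (pow_mem mG 3)) (inv_mem mT)
  · exact mT

lemma closure_pgl_le_planeAut (h0 : ζ ≠ 0) (h3 : ζ ^ 3 = 1) (β : K) :
    Subgroup.closure {pgl (matD ζ), pgl matT, pgl (matG ζ)} ≤ planeAut (symSextic β) := by
  rw [Subgroup.closure_le]
  rintro _ (rfl | rfl | rfl)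
  · exact pgl_mem_planeAut (isUnit_matD h0) (matAct_of_monomial h3 β (by simp))
  · exact pgl_mem_planeAut isUnit_matT (matAct_of_monomial h3 β (by simp))
  · exact pgl_mem_planeAut (isUnit_matG h0) (matAct_of_monomial h3 β (by simp))

/-- A matrix preserving the symmetric sextic is a monomial matrix. -/
lemma exists_monomial_of_matAct_symSextic [CharZero K] {β c : K} (hβ0 : β ≠ 0)
    (hβ10 : β ≠ -10) (A : GL3 K)
    (h : matAct (A : Matrix (Fin 3) (Fin 3) K) (symSextic β) = c • symSextic β) :
    ∃ (i j : ℕ) (a : Fin 3 → K), (∀ l, a l ≠ 0) ∧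
      A.val = matT ^ i * matS ^ j * Matrix.diagonal a := by
  choose σ hσ0 hσ using column_of_matAct_symSextic hβ0 hβ10 A h
  have hsurj : Function.Surjective σ := by
    intro m
    by_contra! hm
    have h1 := congrFun (congrFun A.mul_inv m) m
    rw [Matrix.mul_apply, Finset.sum_eq_zero fun i _ => by rw [hσ i m (hm i).symm, zero_mul]] at h1
    simp at h1
  have hA : A.val = Matrix.of fun j i => if j = σ i then A.val (σ i) i else 0 := by
    ext j i
    by_cases hj : j = σ i
    · simp [hj]
    · simp [hj, hσ i j hj]
  have hinj : Function.Injective σ := Finite.injective_iff_surjective.2 hsurj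
  have h6 : ∀ a b c : Fin 3, a ≠ b → a ≠ c → b ≠ c →
      a = 0 ∧ b = 1 ∧ c = 2 ∨ a = 0 ∧ b = 2 ∧ c = 1 ∨ a = 1 ∧ b = 2 ∧ c = 0 ∨
        a = 2 ∧ b = 0 ∧ c = 1 ∨ a = 1 ∧ b = 0 ∧ c = 2 ∨ a = 2 ∧ b = 1 ∧ c = 0 := by
    decide
  obtain ⟨i, j, hij⟩ : ∃ i j : ℕ, A.val = matT ^ i * matS ^ j *
      Matrix.diagonal fun l => A.val (σ l) l := by
    generalize A.val = M at hA
    rcases h6 (σ 0) (σ 1) (σ 2) (hinj.ne (by decide)) (hinj.ne (by decide))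
      (hinj.ne (by decide)) with h | h | h | h | h | h
    · refine ⟨0, 0, ?_⟩
      rw [hA]; ext j i; fin_cases j <;> fin_cases i <;> simp [h]
    · refine ⟨0, 1, ?_⟩
      rw [hA]; ext j i; fin_cases j <;> fin_cases i <;> simp [h, matS]
    · refine ⟨1, 0, ?_⟩
      rw [hA]; ext j i; fin_cases j <;> fin_cases i <;> simp [h, matT]
    · refine ⟨2, 0, ?_⟩
      rw [hA]; ext j i; fin_cases j <;> fin_cases i <;> simp [h, matT_sq]
    · refine ⟨1, 1, ?_⟩
      rw [hA]; ext j i; fin_cases j <;> fin_cases i <;> simp [h, matT, matS]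
    · refine ⟨2, 1, ?_⟩
      rw [hA]; ext j i; fin_cases j <;> fin_cases i <;> simp [h, matT_sq, matS]
  exact ⟨i, j, _, hσ0, hij⟩

lemma matAct_matS_symSextic (β : K) : matAct matS (symSextic β) = symSextic β := by
  simp only [symSextic, matAct_add, matAct_mul, matAct_pow, matAct_C, matAct_X,
    Fin.sum_univ_three]
  simp [matS]
  ring

lemma matAct_pow_eq_self {A : Matrix (Fin 3) (Fin 3) K} {F : MvPolynomial (Fin 3) K}
    (h : matAct A F = F) (n : ℕ) : matAct (A ^ n) F = F := by
  induction n with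
  | zero => rw [pow_zero, matAct_one]
  | succ n ih => rw [pow_succ, ← matAct_matAct, ih, h]

lemma pow_three_eq_of_matAct_diagonal {β c : K} (hβ0 : β ≠ 0) {a : Fin 3 → K}
    (ha : ∀ l, a l ≠ 0)
    (h : matAct (Matrix.diagonal a) (symSextic β) = c • symSextic β) :
    a 1 ^ 3 = a 0 ^ 3 ∧ a 2 ^ 3 = a 0 ^ 3 := by
  have he (x : Fin 3 → K) := congrArg (eval x) h
  simp only [eval_matAct, smul_eval] at he
  have h0 := he ![1, 0, 0]
  have h1 := he ![0, 1, 0]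
  have h2 := he ![0, 0, 1]
  have h01 := he ![1, 1, 0]
  have h02 := he ![1, 0, 1]
  simp [symSextic, Matrix.mulVec_diagonal] at h0 h1 h2 h01 h02
  constructor
  · refine mul_left_cancel₀ (pow_ne_zero 3 (ha 0)) (mul_left_cancel₀ hβ0 ?_)
    linear_combination h01 - h0 - h1 - β * h0
  · refine mul_left_cancel₀ (pow_ne_zero 3 (ha 0)) (mul_left_cancel₀ hβ0 ?_)
    linear_combination h02 - h0 - h2 - β * h0

lemma planeAut_symSextic_le [CharZero K] (hζ : IsPrimitiveRoot ζ 3) {β : K} (hβ0 : β ≠ 0)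
    (hβ10 : β ≠ -10) :
    planeAut (symSextic β)
      ≤ Subgroup.closure {pgl (matE₁ ζ), pgl (matE₂ ζ), pgl matS, pgl matT} := by
  rintro _ ⟨A, rfl, c, -, h⟩
  have h0 : ζ ≠ 0 := hζ.ne_zero (by norm_num)
  obtain ⟨i, j, a, ha, hA⟩ := exists_monomial_of_matAct_symSextic hβ0 hβ10 A h
  rw [hA, ← matAct_matAct, ← matAct_matAct,
    matAct_pow_eq_self (matAct_of_monomial hζ.pow_eq_one β (by simp)),
    matAct_pow_eq_self (matAct_matS_symSextic β)] at h
  obtain ⟨h1, h2⟩ := pow_three_eq_of_matAct_diagonal hβ0 ha h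
  have hroot (l : Fin 3) (hl : a l ^ 3 = a 0 ^ 3) : ∃ m, a l = a 0 * ζ ^ m := by
    obtain ⟨m, -, hm⟩ := hζ.eq_pow_of_pow_eq_one (ξ := a l / a 0)
      (by rw [div_pow, hl, div_self (pow_ne_zero 3 (ha 0))])
    exact ⟨m, by rw [hm, mul_div_cancel₀ _ (ha 0)]⟩
  obtain ⟨m, hm⟩ := hroot 1 h1
  obtain ⟨n, hn⟩ := hroot 2 h2
  have hdiag : Matrix.diagonal a = a 0 • (matE₁ ζ ^ m * matE₂ ζ ^ n) := by
    rw [matE₁_pow, matE₂_pow]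
    ext k l
    fin_cases k <;> fin_cases l <;> simp [hm, hn]
  have uT := (isUnit_matT (K := K)).pow i
  have uS := (isUnit_matS (K := K)).pow j
  have u₁ := (isUnit_matE₁ h0).pow m
  have u₂ := (isUnit_matE₂ h0).pow n
  rw [← pgl_val, hA, hdiag, mul_smul_comm, pgl_smul ((uT.mul uS).mul (u₁.mul u₂)) (ha 0),
    pgl_mul (uT.mul uS) (u₁.mul u₂), pgl_mul uT uS, pgl_mul u₁ u₂, pgl_pow isUnit_matT,
    pgl_pow isUnit_matS, pgl_pow (isUnit_matE₁ h0), pgl_pow (isUnit_matE₂ h0)]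
  exact mul_mem
    (mul_mem (pow_mem (Subgroup.subset_closure (by simp)) i)
      (pow_mem (Subgroup.subset_closure (by simp)) j))
    (mul_mem (pow_mem (Subgroup.subset_closure (by simp)) m)
      (pow_mem (Subgroup.subset_closure (by simp)) n))

end Matrices

/-- For `β ∉ {0, −10}` with `X⁶ + Y⁶ + Z⁶ + β(X³Y³ + Y³Z³ + X³Z³)` smooth, the
automorphism group is generated by `diag(1, ζ₃, 1)`, `diag(1, 1, ζ₃)`, `[X:Z:Y]` and
`[Z:X:Y]`, and has order `54` (it is isomorphic to `(Z/3Z)² ⋊ Z/6Z`). -/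
theorem symmetricFermatDescendant_sextic_automorphisms
    {K : Type*} [Field K] [IsAlgClosed K] [CharZero K]
    (ζ : K) (hζ : IsPrimitiveRoot ζ 3) (β : K) (hβ0 : β ≠ 0) (hβ10 : β ≠ -10)
    (hsm : IsSmoothSextic (X 0 ^ 6 + X 1 ^ 6 + X 2 ^ 6
      + C β * (X 0 ^ 3 * X 1 ^ 3 + X 1 ^ 3 * X 2 ^ 3 + X 0 ^ 3 * X 2 ^ 3) :
        MvPolynomial (Fin 3) K)) :
    planeAut (X 0 ^ 6 + X 1 ^ 6 + X 2 ^ 6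
        + C β * (X 0 ^ 3 * X 1 ^ 3 + X 1 ^ 3 * X 2 ^ 3 + X 0 ^ 3 * X 2 ^ 3) :
          MvPolynomial (Fin 3) K)
      = Subgroup.closure
        {pgl !![1, 0, 0; 0, ζ, 0; 0, 0, 1], pgl !![1, 0, 0; 0, 1, 0; 0, 0, ζ],
          pgl !![(1 : K), 0, 0; 0, 0, 1; 0, 1, 0], pgl !![(0 : K), 0, 1; 1, 0, 0; 0, 1, 0]} ∧
    Nat.card ↥(planeAut (X 0 ^ 6 + X 1 ^ 6 + X 2 ^ 6
      + C β * (X 0 ^ 3 * X 1 ^ 3 + X 1 ^ 3 * X 2 ^ 3 + X 0 ^ 3 * X 2 ^ 3) :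
        MvPolynomial (Fin 3) K)) = 54 ∧
    (∃ φ : Multiplicative (ZMod 6) →* MulAut (Multiplicative (ZMod 3) × Multiplicative (ZMod 3)),
      Nonempty (↥(planeAut (X 0 ^ 6 + X 1 ^ 6 + X 2 ^ 6
          + C β * (X 0 ^ 3 * X 1 ^ 3 + X 1 ^ 3 * X 2 ^ 3 + X 0 ^ 3 * X 2 ^ 3) :
            MvPolynomial (Fin 3) K))
        ≃* (Multiplicative (ZMod 3) × Multiplicative (ZMod 3)) ⋊[φ]
            Multiplicative (ZMod 6))) := by
  have h0 : ζ ≠ 0 := hζ.ne_zero (by norm_num)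
  have h3 := hζ.pow_eq_one
  obtain ⟨f, hf, hrange⟩ := exists_hom_pgl hζ
  have hle := planeAut_symSextic_le hζ hβ0 hβ10
  have hle' := (closure_le_closure_pgl h0 h3).trans (closure_pgl_le_planeAut h0 h3 β)
  have heq : f.range = planeAut (symSextic β) :=
    hrange.trans ((closure_pgl_le_planeAut h0 h3 β).antisymm
      (hle.trans (closure_le_closure_pgl h0 h3)))
  have e : ThreeThree ⋊[threeThreeAction] Multiplicative (ZMod 6) ≃* planeAut (symSextic β) :=
    (MonoidHom.ofInjective hf).trans (MulEquiv.subgroupCongr heq)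
  refine ⟨hle.antisymm hle', ?_, threeThreeAction, ⟨e.symm⟩⟩
  refine (Nat.card_congr e.symm.toEquiv).trans ?_
  rw [SemidirectProduct.card, Nat.card_prod]
  simp only [Nat.card_eq_fintype_card, Fintype.card_multiplicative, ZMod.card]
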